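/- For all integers i, l ≥ 1, the coefficients of the shallow water moment hierarchy satisfy B_{il1} + 2A_{i1l} = (i+2)/(2i+3) if l = i+1, B_{il1} + 2A_{i1l} = (i−1)/(2i−1) if l = i−1, and B_{il1} + 2A_{i1l} = 0 otherwise. -/

import Mathlib

open Polynomial

/-- The Legendre polynomial of degree `n` (Rodrigues' formula), normalized so `P n 1 = 1`. -/
noncomputable def legendre (n : ℕ) : Polynomial ℝ :=
  ((2 ^ n * n.factorial : ℝ))⁻¹ • (derivative^[n] ((X ^ 2 - 1) ^ n))

/-- The shifted Legendre polynomial `φ_j(ζ) = P_j(1 − 2ζ)` on `[0,1]` with `φ_j(0) = 1`. -/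
noncomputable def phi (j : ℕ) : Polynomial ℝ := (legendre j).comp (1 - 2 * X)

/-- The coefficient `A_{ijk} = (2i+1)·∫₀¹ φ_i φ_j φ_k dζ`. -/
noncomputable def Acoef (i j k : ℕ) : ℝ :=
  (2 * (i : ℝ) + 1) * ∫ ζ in (0 : ℝ)..1, (phi i).eval ζ * (phi j).eval ζ * (phi k).eval ζ

/-- The coefficient `B_{ijk} = (2i+1)·∫₀¹ φ_i'(ζ)·(∫₀^ζ φ_j)·φ_k(ζ) dζ`. -/
noncomputable def Bcoef (i j k : ℕ) : ℝ :=
  (2 * (i : ℝ) + 1) * ∫ ζ in (0 : ℝ)..1,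
    ((phi i).derivative.eval ζ) * (∫ s in (0 : ℝ)..ζ, (phi j).eval s) * (phi k).eval ζ

theorem legendre_zero : legendre 0 = 1 := by simp [legendre]

theorem iterate_derivative_eq_smul_legendre (n : ℕ) :
    derivative^[n] ((X ^ 2 - 1 : ℝ[X]) ^ n) = (2 ^ n * n.factorial : ℝ) • legendre n := by
  have h : (2 ^ n * n.factorial : ℝ) ≠ 0 := by positivity
  rw [legendre, smul_inv_smul₀ h]

theorem derivative_sq_sub_one_pow_succ (n : ℕ) :
    derivative ((X ^ 2 - 1 : ℝ[X]) ^ (n + 1)) =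
      (2 * (n + 1) : ℝ) • (X * (X ^ 2 - 1) ^ n) := by
  rw [derivative_pow_succ, smul_eq_C_mul]
  simp only [derivative_sub, derivative_X_pow, derivative_one, map_mul, map_add, map_natCast,
    map_one, map_ofNat]
  norm_num
  ring

theorem legendre_one : legendre 1 = X := by
  have h := derivative_sq_sub_one_pow_succ 0
  simp only [zero_add, pow_one, pow_zero, mul_one, Nat.cast_zero] at h
  simp [legendre, h, -derivative_sub]

theorem iterate_derivative_X_mul' (n : ℕ) (p : ℝ[X]) :
    derivative^[n + 1] (X * p) = X * derivative^[n + 1] p + (n + 1 : ℝ) • derivative^[n] p := by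
  induction n with
  | zero => simp [add_comm]
  | succ n ih =>
    rw [Function.iterate_succ_apply', ih, derivative_add, derivative_mul, derivative_smul,
      ← Function.iterate_succ_apply' derivative, ← Function.iterate_succ_apply' derivative,
      derivative_X]
    simp only [smul_eq_C_mul, map_add, map_natCast, map_one, Nat.cast_succ]
    ring

theorem derivative_legendre_succ (n : ℕ) :
    derivative (legendre (n + 1)) =
      X * derivative (legendre n) + (n + 1 : ℝ) • legendre n := by
  have h : (2 ^ (n + 1) * (n + 1).factorial : ℝ) ≠ 0 := by positivity
  apply smul_right_injective _ h
  simp only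
  rw [← derivative_smul, ← iterate_derivative_eq_smul_legendre, ← Function.iterate_succ_apply' derivative,
    Function.iterate_succ_apply, derivative_sq_sub_one_pow_succ, iterate_derivative_smul,
    iterate_derivative_X_mul', Function.iterate_succ_apply',
    iterate_derivative_eq_smul_legendre, Nat.factorial_succ]
  simp only [derivative_smul]
  simp only [smul_eq_C_mul, map_mul, map_add, map_natCast, map_one, map_ofNat, map_pow,
    Nat.cast_mul, Nat.cast_succ]
  ring

theorem derivative_legendre_add_two (n : ℕ) :
    derivative (legendre (n + 2)) =
      derivative (legendre n) + (2 * n + 3 : ℝ) • legendre (n + 1) := by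
  have h : (2 ^ (n + 2) * (n + 2).factorial : ℝ) ≠ 0 := by positivity
  apply smul_right_injective _ h
  simp only
  have key : derivative (derivative ((X ^ 2 - 1 : ℝ[X]) ^ (n + 2))) =
      (2 * (n + 2) * (2 * n + 3) : ℝ) • (X ^ 2 - 1) ^ (n + 1) +
        (4 * (n + 2) * (n + 1) : ℝ) • (X ^ 2 - 1) ^ n := by
    rw [derivative_sq_sub_one_pow_succ, derivative_smul, derivative_mul,
      derivative_sq_sub_one_pow_succ]
    simp only [derivative_X, smul_eq_C_mul, map_mul, map_add, map_natCast, map_one, map_ofNat,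
      Nat.cast_succ]
    ring
  rw [← derivative_smul, ← iterate_derivative_eq_smul_legendre, ← Function.iterate_succ_apply' derivative,
    Function.iterate_succ_apply, Function.iterate_succ_apply, key, iterate_map_add,
    iterate_derivative_smul, iterate_derivative_smul, iterate_derivative_eq_smul_legendre,
    Function.iterate_succ_apply', iterate_derivative_eq_smul_legendre,
    Nat.factorial_succ (n + 1), Nat.factorial_succ]
  simp only [derivative_smul]
  simp only [smul_eq_C_mul, map_mul, map_add, map_natCast, map_one, map_ofNat, map_pow,
    Nat.cast_mul, Nat.cast_succ]
  ring

theorem eval_legendre_succ_of_sq_eq_one {x : ℝ} (hx : x ^ 2 = 1) (n : ℕ) :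
    (legendre (n + 1)).eval x = x * (legendre n).eval x := by
  rcases n with _ | n
  · simp [legendre_zero, legendre_one]
  have h : (2 ^ (n + 2) * (n + 2).factorial : ℝ) ≠ 0 := by positivity
  have hdvd : (X ^ 2 - 1 : ℝ[X]) ∣ derivative^[n] ((X ^ 2 - 1 : ℝ[X]) ^ (n + 1)) := by
    simpa using pow_sub_dvd_iterate_derivative_pow (X ^ 2 - 1 : ℝ[X]) (n + 1) n
  have hzero : (derivative^[n] ((X ^ 2 - 1 : ℝ[X]) ^ (n + 1))).eval x = 0 := by
    obtain ⟨q, hq⟩ := hdvd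
    simp [hq, hx]
  apply mul_left_cancel₀ h
  rw [← smul_eq_mul, ← eval_smul, ← iterate_derivative_eq_smul_legendre,
    Function.iterate_succ_apply, derivative_sq_sub_one_pow_succ, iterate_derivative_smul,
    iterate_derivative_X_mul', iterate_derivative_eq_smul_legendre, Nat.factorial_succ (n + 1)]
  simp only [eval_smul, eval_add, eval_mul, eval_X, smul_eq_mul, hzero]
  push_cast
  ring

theorem eval_one_legendre (n : ℕ) : (legendre n).eval 1 = 1 := by
  induction n with
  | zero => simp [legendre_zero]
  | succ n ih => rw [eval_legendre_succ_of_sq_eq_one (by norm_num), ih, one_mul]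

theorem legendre_three_term (n : ℕ) :
    (2 * n + 1 : ℝ) • (X * legendre n) =
      (n + 1 : ℝ) • legendre (n + 1) + (n : ℝ) • legendre (n - 1) := by
  rcases n with _ | n
  · simp [legendre_zero, legendre_one]
  rw [← sub_eq_zero]
  set q := (2 * (n + 1 : ℕ) + 1 : ℝ) • (X * legendre (n + 1)) -
    (((n + 1 : ℕ) + 1 : ℝ) • legendre (n + 1 + 1) +
      ((n + 1 : ℕ) : ℝ) • legendre (n + 1 - 1)) with hq
  have hd : derivative q = 0 := by
    have h1 := derivative_legendre_succ (n + 1)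
    have h2 := derivative_legendre_add_two n
    rw [h1] at h2
    simp only [smul_eq_C_mul, map_mul, map_add, map_natCast, map_one, map_ofNat,
      Nat.cast_succ] at h1 h2
    simp only [hq, Nat.add_sub_cancel, derivative_sub, derivative_add, derivative_smul,
      derivative_mul, derivative_X]
    simp only [smul_eq_C_mul, map_mul, map_add, map_natCast, map_one, map_ofNat, Nat.cast_succ]
    linear_combination (-(n : ℝ[X]) - 2) * h1 + ((n : ℝ[X]) + 1) * h2
  have hc := eq_C_of_derivative_eq_zero hd
  have he : q.eval 1 = 0 := by
    simp only [hq, eval_sub, eval_add, eval_smul, eval_mul, eval_X, eval_one_legendre, smul_eq_mul]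
    ring
  rw [hc, eval_C] at he
  rw [hc, he, C_0]

theorem phi_zero : phi 0 = 1 := by simp [phi, legendre_zero]

theorem phi_one : phi 1 = 1 - 2 * X := by simp [phi, legendre_one]

theorem phi_three_term (n : ℕ) :
    (2 * n + 1 : ℝ) • (phi 1 * phi n) =
      (n + 1 : ℝ) • phi (n + 1) + (n : ℝ) • phi (n - 1) := by
  have h := congrArg (fun p => p.comp (1 - 2 * X : ℝ[X])) (legendre_three_term n)
  rw [phi_one]
  simpa only [phi, smul_comp, add_comp, mul_comp, X_comp] using h

theorem eval_zero_phi (n : ℕ) : (phi n).eval 0 = 1 := by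
  simp [phi, eval_one_legendre]

theorem eval_one_phi_add_two (n : ℕ) : (phi (n + 2)).eval 1 = (phi n).eval 1 := by
  have h : (1 : ℝ) - 2 = -1 := by norm_num
  simp only [phi, eval_comp, eval_sub, eval_mul, eval_one, eval_ofNat, eval_X, mul_one, h]
  rw [eval_legendre_succ_of_sq_eq_one (by norm_num), eval_legendre_succ_of_sq_eq_one (by norm_num)]
  ring

/-- The primitive of `phi (n + 1)` vanishing at `0`. -/
noncomputable def phiPrimitive (n : ℕ) : ℝ[X] :=
  (2 * (2 * n + 3) : ℝ)⁻¹ • (phi n - phi (n + 2))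

theorem derivative_phiPrimitive (n : ℕ) : derivative (phiPrimitive n) = phi (n + 1) := by
  have h : (2 * (2 * n + 3) : ℝ) ≠ 0 := by positivity
  have hlin : derivative (1 - 2 * X : ℝ[X]) = -2 := by simp
  rw [phiPrimitive, derivative_smul, inv_smul_eq_iff₀ h, derivative_sub]
  simp only [phi, derivative_comp, hlin, derivative_legendre_add_two, add_comp, smul_comp]
  simp only [smul_eq_C_mul, map_mul, map_add, map_natCast, map_ofNat]
  ring

theorem eval_zero_phiPrimitive (n : ℕ) : (phiPrimitive n).eval 0 = 0 := by
  simp [phiPrimitive, eval_zero_phi]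

theorem eval_one_phiPrimitive (n : ℕ) : (phiPrimitive n).eval 1 = 0 := by
  simp [phiPrimitive, eval_one_phi_add_two]

theorem integral_eval_derivative (p : ℝ[X]) (a b : ℝ) :
    ∫ x in a..b, (derivative p).eval x = p.eval b - p.eval a :=
  intervalIntegral.integral_eq_sub_of_hasDerivAt (fun x _ => p.hasDerivAt x)
    ((derivative p).continuous.intervalIntegrable _ _)

/-- Integration over the unit interval as a linear functional on polynomials. -/
noncomputable def unitIntegral : ℝ[X] →ₗ[ℝ] ℝ where
  toFun p := ∫ x in (0 : ℝ)..1, p.eval x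
  map_add' p q := by
    simp only [eval_add]
    exact intervalIntegral.integral_add (p.continuous.intervalIntegrable _ _)
      (q.continuous.intervalIntegrable _ _)
  map_smul' c p := by simp

theorem unitIntegral_apply (p : ℝ[X]) : unitIntegral p = ∫ x in (0 : ℝ)..1, p.eval x := rfl

theorem unitIntegral_derivative (p : ℝ[X]) :
    unitIntegral (derivative p) = p.eval 1 - p.eval 0 :=
  integral_eval_derivative p 0 1

theorem unitIntegral_phi (n : ℕ) : unitIntegral (phi n) = if n = 0 then 1 else 0 := by
  rcases n with _ | n
  · simp [phi_zero, unitIntegral_apply]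
  · rw [← derivative_phiPrimitive, unitIntegral_derivative, eval_one_phiPrimitive,
      eval_zero_phiPrimitive]
    simp

theorem unitIntegral_phi_one_mul (n : ℕ) (p : ℝ[X]) :
    (2 * n + 1 : ℝ) * unitIntegral (phi 1 * phi n * p) =
      (n + 1) * unitIntegral (phi (n + 1) * p) + n * unitIntegral (phi (n - 1) * p) := by
  have h := congrArg (fun q => unitIntegral (q * p)) (phi_three_term n)
  simpa only [add_mul, smul_mul_assoc, map_add, map_smul, smul_eq_mul] using h

theorem unitIntegral_phi_mul_phi (j : ℕ) : ∀ i,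
    unitIntegral (phi i * phi j) = if i = j then (2 * j + 1 : ℝ)⁻¹ else 0 := by
  induction j using Nat.strong_induction_on with
  | _ j ih =>
    intro i
    rcases j with _ | j
    · simp [phi_zero, unitIntegral_phi]
    have h1 := unitIntegral_phi_one_mul j (phi i)
    have h2 := unitIntegral_phi_one_mul i (phi j)
    rw [ih j (by omega), ih j (by omega)] at h2
    have h3 : (j : ℝ) * unitIntegral (phi (j - 1) * phi i) =
        j * if i = j - 1 then (2 * j - 1 : ℝ)⁻¹ else 0 := by
      rcases j with _ | j
      · simp
      · rw [mul_comm (phi _), Nat.add_sub_cancel, ih j (by omega)]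
        push_cast
        ring_nf
    rw [h3, mul_right_comm (phi 1), mul_comm (phi (j + 1))] at h1
    have hi : (2 * i + 1 : ℝ) ≠ 0 := by positivity
    have hj : (2 * j + 1 : ℝ) ≠ 0 := by positivity
    have hj' : (j + 1 : ℝ) ≠ 0 := by positivity
    have h4 : unitIntegral (phi 1 * phi i * phi j) = (2 * i + 1 : ℝ)⁻¹ *
      ((i + 1) * (if i + 1 = j then (2 * j + 1 : ℝ)⁻¹ else 0) +
        i * (if i - 1 = j then (2 * j + 1 : ℝ)⁻¹ else 0)) := by
      rw [← h2, inv_mul_cancel_left₀ hi]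
    rw [h4] at h1
    apply mul_left_cancel₀ hj'
    rw [← sub_eq_iff_eq_add] at h1
    rw [← h1]
    by_cases c1 : i = j + 1
    · subst c1
      rw [if_neg (by omega), if_pos (by omega), if_neg (by omega), if_pos rfl]
      push_cast at hi ⊢
      field_simp
      ring
    by_cases c2 : i + 1 = j
    · subst c2
      rw [if_pos rfl, if_neg (by omega), if_pos (by omega), if_neg (by omega)]
      have : (2 * ((i + 1 : ℕ) : ℝ) - 1) = 2 * i + 1 := by push_cast; ring
      rw [this]
      push_cast at hj ⊢
      field_simp
      ring
    rw [if_neg c2, if_neg c1]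
    have h5 : (i : ℝ) * (if i - 1 = j then (2 * j + 1 : ℝ)⁻¹ else 0) = 0 := by
      rcases i with _ | i
      · simp
      · rw [if_neg (by omega), mul_zero]
    have h6 : (j : ℝ) * (if i = j - 1 then (2 * j - 1 : ℝ)⁻¹ else 0) = 0 := by
      rcases j with _ | j
      · simp
      · rw [if_neg (by omega), mul_zero]
    rw [h5, h6]
    ring

theorem Acoef_eq (i j k : ℕ) :
    Acoef i j k = (2 * i + 1) * unitIntegral (phi i * phi j * phi k) := by
  simp [Acoef, unitIntegral_apply]

theorem integral_phi_succ (n : ℕ) (x : ℝ) :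
    ∫ s in (0 : ℝ)..x, (phi (n + 1)).eval s = (phiPrimitive n).eval x := by
  rw [← derivative_phiPrimitive, integral_eval_derivative, eval_zero_phiPrimitive, sub_zero]

theorem Bcoef_succ_one (i n : ℕ) :
    Bcoef i (n + 1) 1 = (2 * i + 1) *
      (2 * unitIntegral (phi i * phiPrimitive n) -
        unitIntegral (phi i * phi 1 * phi (n + 1))) := by
  have h : Bcoef i (n + 1) 1 =
      (2 * i + 1) * unitIntegral (derivative (phi i) * phiPrimitive n * phi 1) := by
    simp [Bcoef, unitIntegral_apply, integral_phi_succ]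
  have hparts := unitIntegral_derivative (phi i * phiPrimitive n * phi 1)
  have hlin : derivative (phi 1) = C (-2 : ℝ) := by simp [phi_one, C_ofNat]
  have hsplit : derivative (phi i * phiPrimitive n * phi 1) =
      derivative (phi i) * phiPrimitive n * phi 1 + phi i * phi 1 * phi (n + 1) +
        (-2 : ℝ) • (phi i * phiPrimitive n) := by
    rw [derivative_mul, derivative_mul, derivative_phiPrimitive, hlin, smul_eq_C_mul]
    ring
  rw [hsplit] at hparts
  simp only [map_add, map_smul, smul_eq_mul, eval_mul, eval_one_phiPrimitive,
    eval_zero_phiPrimitive] at hparts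
  rw [h]
  linear_combination (2 * (i : ℝ) + 1) * hparts

theorem Bcoef_add_two_mul_Acoef (i n : ℕ) :
    Bcoef i (n + 1) 1 + 2 * Acoef i 1 (n + 1) = (2 * i + 1) / (2 * n + 3) *
      ((n + 1) * unitIntegral (phi i * phi (n + 2)) +
        (n + 2) * unitIntegral (phi i * phi n)) := by
  have h := unitIntegral_phi_one_mul (n + 1) (phi i)
  have hprim : unitIntegral (phi i * phiPrimitive n) = (2 * (2 * n + 3) : ℝ)⁻¹ *
      (unitIntegral (phi i * phi n) - unitIntegral (phi i * phi (n + 2))) := by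
    rw [phiPrimitive, mul_smul_comm, map_smul, mul_sub, map_sub, smul_eq_mul]
  rw [show phi 1 * phi (n + 1) * phi i = phi i * phi 1 * phi (n + 1) by ring,
    mul_comm _ (phi i), mul_comm _ (phi i), Nat.add_sub_cancel] at h
  push_cast at h
  rw [Bcoef_succ_one, Acoef_eq, hprim]
  have hn : (2 * n + 3 : ℝ) ≠ 0 := by positivity
  field_simp
  linear_combination h

/-- `B_{il1} + 2A_{i1l}` equals `(i+2)/(2i+3)` if `l = i+1`, `(i−1)/(2i−1)` if `l = i−1`,
and `0` otherwise. -/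
theorem stmt_9 (i l : ℕ) (hi : 1 ≤ i) (hl : 1 ≤ l) :
    Bcoef i l 1 + 2 * Acoef i 1 l =
      if l = i + 1 then ((i : ℝ) + 2) / (2 * (i : ℝ) + 3)
      else if i = l + 1 then ((i : ℝ) - 1) / (2 * (i : ℝ) - 1)
      else 0 := by
  obtain ⟨n, rfl⟩ := Nat.exists_eq_add_of_le' hl
  rw [Bcoef_add_two_mul_Acoef, unitIntegral_phi_mul_phi, unitIntegral_phi_mul_phi]
  by_cases h1 : n = i
  · subst h1
    rw [if_neg (by omega), if_pos rfl, if_pos rfl]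
    field_simp
    ring
  by_cases h2 : i = n + 2
  · subst h2
    rw [if_pos rfl, if_neg (by omega), if_neg (by omega), if_pos rfl]
    have h3 : 2 * ((n + 2 : ℕ) : ℝ) - 1 = 2 * n + 3 := by push_cast; ring
    rw [h3]
    push_cast
    field_simp
    ring
  · rw [if_neg (by omega), if_neg (by omega), if_neg (by omega), if_neg (by omega)]
    ring
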